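/- For all integers 1 ≤ k ≤ s ≤ d there exists a polytope P in ℝ^d such that the family 𝒩 of inner unit normal vectors of the facets of P has absolute rank k, and the inner neighborhood volume function V_P is of differentiability class C^{s−1} on [0,∞) but not of class C^s. -/

import Mathlib

open MeasureTheory Metric Set
open scoped RealInnerProductSpace

/-- The `r`-interior of a set `P`: points of `P` at distance at least `r` from `∂P`. -/
noncomputable def innerInterior {d : ℕ} (P : Set (EuclideanSpace ℝ (Fin d))) (r : ℝ) :
    Set (EuclideanSpace ℝ (Fin d)) :=
  {x ∈ P | r ≤ infDist x (frontier P)}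

/-- The inner neighborhood volume function `V_P(r) = vol_d(P \ P(r))`. -/
noncomputable def VP {d : ℕ} (P : Set (EuclideanSpace ℝ (Fin d))) (r : ℝ) : ℝ :=
  (volume (P \ innerInterior P r)).toReal

/-- A finite family of vectors has absolute rank `k` if any `k` of its elements are
linearly independent, and some `k+1` of them are linearly dependent. -/
def AbsoluteRank {E : Type*} [AddCommGroup E] [Module ℝ E] {m : ℕ}
    (N : Fin m → E) (k : ℕ) : Prop :=
  (∀ s : Finset (Fin m), s.card = k → LinearIndependent ℝ (fun i : s => N (i : Fin m))) ∧
  ∃ s : Finset (Fin m), s.card = k + 1 ∧ ¬ LinearIndependent ℝ (fun i : s => N (i : Fin m))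

open scoped ContDiff

/-- The polyhedron `{x | ∀ j, c j ≤ ⟪x, u j⟫}` with inner normals `u` and offsets `c`. -/
def polyhedron {E J : Type*} [NormedAddCommGroup E] [InnerProductSpace ℝ E]
    (u : J → E) (c : J → ℝ) : Set E :=
  {x | ∀ j, c j ≤ ⟪x, u j⟫}

/-- The facet description `(u, c)` of a polytope with the origin in its interior, such that no
facet inequality is redundant and any `k` of the unit normals are linearly independent. -/
structure IsFacetSystem {E J : Type*} [NormedAddCommGroup E] [InnerProductSpace ℝ E]
    (u : J → E) (c : J → ℝ) (k : ℕ) : Prop where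
  norm_eq_one : ∀ j, ‖u j‖ = 1
  neg : ∀ j, c j < 0
  exists_cut : ∀ j, ∃ x, ⟪x, u j⟫ < c j ∧ ∀ i, i ≠ j → c i ≤ ⟪x, u i⟫
  isBounded : Bornology.IsBounded (polyhedron u c)
  linearIndepOn : ∀ t : Finset J, t.card ≤ k → LinearIndepOn ℝ u (t : Set J)

section Polyhedron

variable {E J : Type*} [NormedAddCommGroup E] [InnerProductSpace ℝ E] {u : J → E} {c : J → ℝ}

theorem isClosed_polyhedron (u : J → E) (c : J → ℝ) : IsClosed (polyhedron u c) := by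
  have : polyhedron u c = ⋂ j, {x | c j ≤ ⟪x, u j⟫} := by
    ext x; simp [polyhedron]
  rw [this]
  exact isClosed_iInter fun j => isClosed_le continuous_const (by fun_prop)

theorem mem_interior_polyhedron [Finite J] {x : E} (hx : ∀ j, c j < ⟪x, u j⟫) :
    x ∈ interior (polyhedron u c) := by
  have ho : IsOpen (⋂ j, {x : E | c j < ⟪x, u j⟫}) :=
    isOpen_iInter_of_finite fun j => isOpen_lt continuous_const (by fun_prop)
  refine interior_maximal (fun y hy j => ?_) ho (by simpa using hx)
  exact (mem_iInter.1 hy j).le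

theorem exists_inner_eq_of_mem_frontier_polyhedron [Finite J] {x : E}
    (hx : x ∈ frontier (polyhedron u c)) : ∃ j, ⟪x, u j⟫ = c j := by
  by_contra! h
  have hmem : x ∈ polyhedron u c := (isClosed_polyhedron u c).frontier_subset hx
  exact hx.2 (mem_interior_polyhedron fun j => lt_of_le_of_ne (hmem j) (h j).symm)

theorem infDist_frontier_polyhedron_le (hu : ∀ j, ‖u j‖ = 1) {x : E}
    (hx : x ∈ polyhedron u c) (j : J) :
    infDist x (frontier (polyhedron u c)) ≤ ⟪x, u j⟫ - c j := by
  refine le_of_forall_pos_le_add fun ε hε => ?_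
  set a := ⟪x, u j⟫ - c j + ε with ha
  have ha0 : 0 ≤ a := by have := hx j; linarith
  have hy : x - a • u j ∉ polyhedron u c := fun h => by
    have := h j
    rw [inner_sub_left, inner_smul_left, real_inner_self_eq_norm_sq, hu j] at this
    simp only [conj_trivial, one_pow, mul_one] at this
    linarith
  obtain ⟨z, hz, hzf⟩ : (segment ℝ x (x - a • u j) ∩ frontier (polyhedron u c)).Nonempty := by
    by_contra hdisj
    rw [not_nonempty_iff_eq_empty, eq_empty_iff_forall_notMem] at hdisj
    have hcl := isClosed_polyhedron u c
    have hcover : segment ℝ x (x - a • u j) ⊆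
        interior (polyhedron u c) ∪ (polyhedron u c)ᶜ := fun z hz => by
      by_contra hz'
      rw [mem_union, not_or, notMem_compl_iff] at hz'
      exact hdisj z ⟨hz, by rw [hcl.frontier_eq]; exact ⟨hz'.2, hz'.1⟩⟩
    obtain ⟨z, -, hz1, hz2⟩ := (convex_segment x (x - a • u j)).isPreconnected _ _
      isOpen_interior hcl.isOpen_compl hcover
      ⟨x, left_mem_segment ℝ _ _, (hcover (left_mem_segment ℝ _ _)).resolve_right (by simpa)⟩
      ⟨_, right_mem_segment ℝ _ _, hy⟩
    exact hz2 (interior_subset hz1)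
  refine (infDist_le_dist_of_mem hzf).trans ?_
  rw [segment_eq_image'] at hz
  obtain ⟨θ, hθ, rfl⟩ := hz
  rw [dist_eq_norm]
  have : x - (x + θ • (x - a • u j - x)) = (θ * a) • u j := by module
  rw [this, norm_smul, hu j, mul_one, Real.norm_of_nonneg (mul_nonneg hθ.1 ha0)]
  nlinarith [hθ.2]

theorem le_infDist_frontier_polyhedron [Finite J] (hu : ∀ j, ‖u j‖ = 1) {x : E} {r : ℝ}
    (hne : (frontier (polyhedron u c)).Nonempty) (hx : ∀ j, c j + r ≤ ⟪x, u j⟫) :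
    r ≤ infDist x (frontier (polyhedron u c)) := by
  refine (le_infDist hne).2 fun y hy => ?_
  obtain ⟨j, hj⟩ := exists_inner_eq_of_mem_frontier_polyhedron hy
  have h1 : ⟪x - y, u j⟫ ≤ ‖x - y‖ * ‖u j‖ := real_inner_le_norm _ _
  rw [inner_sub_left, hj, hu j, mul_one] at h1
  rw [dist_eq_norm]
  linarith [hx j]

end Polyhedron

theorem innerInterior_polyhedron {d : ℕ} {J : Type*} [Finite J]
    {u : J → EuclideanSpace ℝ (Fin d)} {c : J → ℝ} (hu : ∀ j, ‖u j‖ = 1)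
    (hne : (frontier (polyhedron u c)).Nonempty) {r : ℝ} (hr : 0 ≤ r) :
    innerInterior (polyhedron u c) r = polyhedron u (fun j => c j + r) := by
  ext x
  constructor
  · rintro ⟨hx, hxr⟩ j
    linarith [infDist_frontier_polyhedron_le hu hx j]
  · intro hx
    exact ⟨fun j => by linarith [hx j], le_infDist_frontier_polyhedron hu hne hx⟩

theorem hasDerivAt_max_sub_pow (n : ℕ) (a r : ℝ) :
    HasDerivAt (fun r : ℝ => (max (a - r) 0) ^ (n + 2))
      (-(n + 2 : ℝ) * (max (a - r) 0) ^ (n + 1)) r := by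
  have hne : ∀ y ≠ a, HasDerivAt (fun r : ℝ => (max (a - r) 0) ^ (n + 2))
      (-(n + 2 : ℝ) * (max (a - y) 0) ^ (n + 1)) y := by
    intro y hy
    rcases lt_or_gt_of_ne hy with h | h
    · have h1 : HasDerivAt (fun r : ℝ => (a - r) ^ (n + 2))
          (-(n + 2 : ℝ) * (max (a - y) 0) ^ (n + 1)) y := by
        rw [max_eq_left (by linarith)]
        refine (((hasDerivAt_id' y).const_sub a).fun_pow (n + 2)).congr_deriv ?_
        push_cast
        ring
      refine h1.congr_of_eventuallyEq ?_
      filter_upwards [eventually_lt_nhds h] with z hz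
      rw [max_eq_left (by linarith)]
    · rw [max_eq_right (by linarith), zero_pow (by omega), mul_zero]
      refine (hasDerivAt_const y (0 : ℝ)).congr_of_eventuallyEq ?_
      filter_upwards [eventually_gt_nhds h] with z hz
      rw [max_eq_right (by linarith), zero_pow (by omega)]
  rcases eq_or_ne r a with rfl | h
  · exact hasDerivAt_of_hasDerivAt_of_ne hne (by fun_prop) (by fun_prop)
  · exact hne r h

theorem contDiff_max_sub_pow (n : ℕ) (a : ℝ) :
    ContDiff ℝ n (fun r : ℝ => (max (a - r) 0) ^ (n + 1)) := by
  induction n with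
  | zero => exact contDiff_zero.2 (by fun_prop)
  | succ n ih =>
    push_cast
    refine contDiff_succ_iff_deriv.2
      ⟨fun r => (hasDerivAt_max_sub_pow n a r).differentiableAt, by simp, ?_⟩
    rw [show deriv (fun r : ℝ => (max (a - r) 0) ^ (n + 1 + 1)) = _ from
      funext fun r => (hasDerivAt_max_sub_pow n a r).deriv]
    exact contDiff_const.mul ih

theorem not_contDiffAt_max_sub_pow (n : ℕ) (a : ℝ) :
    ¬ ContDiffAt ℝ (n + 1 : ℕ) (fun r : ℝ => (max (a - r) 0) ^ (n + 1)) a := by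
  induction n with
  | zero =>
    intro h
    have h1 : DifferentiableAt ℝ (fun r : ℝ => (max (a - r) 0) ^ (0 + 1)) (a - 0) := by
      rw [sub_zero]; exact h.differentiableAt (by simp)
    have h2 : DifferentiableAt ℝ (fun t : ℝ => a - t) 0 := by fun_prop
    have h3 : DifferentiableAt ℝ (fun t : ℝ => 2 * (max (a - (a - t)) 0) ^ (0 + 1) - t) 0 :=
      ((h1.comp (0 : ℝ) h2).const_mul 2).sub differentiableAt_id
    refine not_differentiableAt_abs_zero (h3.congr_of_eventuallyEq (.of_forall fun t => ?_))
    rcases le_total 0 t with ht | ht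
    · simp [abs_of_nonneg ht, ht]; ring
    · simp [abs_of_nonpos ht, ht]
  | succ n ih =>
    intro h
    have h1 : ContDiffAt ℝ (n + 1 : ℕ)
        (fun r : ℝ => deriv (fun r : ℝ => (max (a - r) 0) ^ (n + 1 + 1)) r) a := by
      have := (h.fderiv_right (m := (n + 1 : ℕ)) (by push_cast; rfl)).clm_apply
        (contDiffAt_const (c := (1 : ℝ)))
      simpa using this
    rw [show deriv (fun r : ℝ => (max (a - r) 0) ^ (n + 1 + 1)) = _ from
      funext fun r => (hasDerivAt_max_sub_pow n a r).deriv] at h1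
    refine ih (((contDiffAt_const (c := (-(n + 2 : ℝ))⁻¹)).mul h1).congr_of_eventuallyEq
      (.of_forall fun r => ?_))
    have : (-(n + 2 : ℝ)) ≠ 0 := by have : (0 : ℝ) < n + 2 := by positivity
                                    linarith
    simp only
    field_simp

/-- A function on `[0, ∞)` of the form `c - (1 - r)₊ ^ s * G r` with `G` smooth and `G 1 ≠ 0`
is of class `C^(s-1)` but not of class `C^s`. -/
theorem contDiffOn_and_not_contDiffOn_of_eq {s : ℕ} (hs : 1 ≤ s) {V G : ℝ → ℝ} {c : ℝ}
    (hG : ContDiff ℝ ∞ G) (hG1 : G 1 ≠ 0)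
    (hV : ∀ r, 0 ≤ r → V r = c - (max (1 - r) 0) ^ s * G r) :
    ContDiffOn ℝ (s - 1 : ℕ) V (Ici 0) ∧ ¬ ContDiffOn ℝ (s : ℕ) V (Ici 0) := by
  obtain ⟨n, rfl⟩ : ∃ n, s = n + 1 := ⟨s - 1, by omega⟩
  rw [Nat.add_sub_cancel]
  have hle : ∀ m : ℕ, (m : WithTop ℕ∞) ≤ ∞ := fun m => by exact_mod_cast le_top
  refine ⟨?_, fun h => not_contDiffAt_max_sub_pow n 1 ?_⟩
  · exact ((contDiff_const.sub ((contDiff_max_sub_pow n 1).mul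
      (hG.of_le (hle n)))).contDiffOn (s := Ici 0)).congr fun r hr => hV r hr
  · have h1 := h.contDiffAt (x := 1) (Ici_mem_nhds one_pos)
    have h2 : ContDiffAt ℝ (n + 1 : ℕ) (fun r => (c - V r) / G r) 1 :=
      (contDiffAt_const.sub h1).div (hG.of_le (hle _)).contDiffAt hG1
    refine h2.congr_of_eventuallyEq ?_
    filter_upwards [hG.continuous.continuousAt.eventually_ne hG1, Ici_mem_nhds one_pos]
      with r hr hr0
    rw [hV r hr0]
    field_simp
    ring

/-- The offsets of the bundle of simplices: `-1` on the base and `-R` on the fibre. -/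
def extOffsets (J κ : Type*) (R : ℝ) : J ⊕ Option κ → ℝ :=
  Sum.elim (fun _ => -1) fun _ => -R

theorem extOffsets_one (J κ : Type*) : extOffsets J κ 1 = fun _ => -1 := by
  ext j; rcases j with j | o <;> rfl

section Extension

open WithLp Module Pointwise

variable {E J κ : Type*} [NormedAddCommGroup E] [Fintype κ]

/-- The vector `(w, -1, …, -1)`. -/
noncomputable def slantVec (κ : Type*) [Fintype κ] (w : E) :
    WithLp 2 (E × EuclideanSpace ℝ κ) :=
  toLp 2 (w, toLp 2 fun _ => -1)

theorem one_le_norm_slantVec [Nonempty κ] (w : E) : 1 ≤ ‖slantVec κ w‖ := by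
  have h : ‖slantVec κ w‖ ^ 2 = ‖w‖ ^ 2 + Fintype.card κ := by
    rw [slantVec, WithLp.prod_norm_sq_eq_of_L2]
    simp [EuclideanSpace.norm_sq_eq]
  have : (1 : ℝ) ≤ Fintype.card κ := by exact_mod_cast Fintype.card_pos
  nlinarith [norm_nonneg (slantVec κ w), sq_nonneg ‖w‖]

variable [InnerProductSpace ℝ E]

open Classical in
/-- The normals of a bundle of simplices over a polytope with normals `u`: those of the base,
the coordinate vectors of the fibre, and the normalization of `(w, -1, …, -1)`. -/
noncomputable def extNormals (u : J → E) (w : E) :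
    J ⊕ Option κ → WithLp 2 (E × EuclideanSpace ℝ κ)
  | .inl j => toLp 2 (u j, 0)
  | .inr (some i) => toLp 2 (0, EuclideanSpace.single i 1)
  | .inr none => ‖slantVec κ w‖⁻¹ • slantVec κ w

theorem inner_slantVec (p : WithLp 2 (E × EuclideanSpace ℝ κ)) (w : E) :
    ⟪p, slantVec κ w⟫ = ⟪p.fst, w⟫ - ∑ i, p.snd i := by
  simp [slantVec, PiLp.inner_apply, sub_eq_add_neg]

theorem inner_extNormals_inl (u : J → E) (w : E) (p : WithLp 2 (E × EuclideanSpace ℝ κ)) (j : J) :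
    ⟪p, extNormals u w (.inl j)⟫ = ⟪p.fst, u j⟫ := by
  simp [extNormals]

theorem inner_extNormals_some (u : J → E) (w : E) (p : WithLp 2 (E × EuclideanSpace ℝ κ)) (i : κ) :
    ⟪p, extNormals u w (.inr (some i))⟫ = p.snd i := by
  classical
  simp [extNormals, EuclideanSpace.inner_single_right]

theorem le_inner_extNormals_none [Nonempty κ] (u : J → E) (w : E)
    (p : WithLp 2 (E × EuclideanSpace ℝ κ)) (a : ℝ) :
    a ≤ ⟪p, extNormals u w (.inr none)⟫ ↔
      a * ‖slantVec κ w‖ ≤ ⟪p.fst, w⟫ - ∑ i, p.snd i := by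
  have h := one_le_norm_slantVec (κ := κ) w
  rw [extNormals, inner_smul_right, inner_slantVec, inv_mul_eq_div, le_div_iff₀ (by linarith)]

theorem mem_polyhedron_extNormals [Nonempty κ] (u : J → E) (w : E) (R r : ℝ)
    (p : WithLp 2 (E × EuclideanSpace ℝ κ)) :
    p ∈ polyhedron (extNormals u w) (fun j => extOffsets J κ R j + r) ↔
      p.fst ∈ polyhedron u (fun _ => -1 + r) ∧ (∀ i, r - R ≤ p.snd i) ∧
        (r - R) * ‖slantVec κ w‖ ≤ ⟪p.fst, w⟫ - ∑ i, p.snd i := by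
  simp only [polyhedron, mem_ofPred_eq, Sum.forall, Option.forall, inner_extNormals_inl,
    inner_extNormals_some, le_inner_extNormals_none]
  simp only [extOffsets, Sum.elim_inl, Sum.elim_inr, neg_add_eq_sub]
  tauto

theorem norm_extNormals [Nonempty κ] {u : J → E} (hu : ∀ j, ‖u j‖ = 1) (w : E)
    (j : J ⊕ Option κ) : ‖extNormals u w j‖ = 1 := by
  classical
  rcases j with j | _ | i
  · simp [extNormals, hu]
  · have h := one_le_norm_slantVec (κ := κ) w
    rw [extNormals, norm_smul, norm_inv, norm_norm, inv_mul_cancel₀ (by linarith)]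
  · simp [extNormals]

theorem linearIndepOn_extNormals [Nonempty κ] {u : J → E} {w : E} {k : ℕ}
    (hu : ∀ t : Finset J, t.card ≤ k → LinearIndepOn ℝ u (t : Set J))
    (hw : ∀ t : Finset J, t.card + (Fintype.card κ + 1) ≤ k →
      w ∉ Submodule.span ℝ (u '' (t : Set J)))
    (t : Finset (J ⊕ Option κ)) (ht : t.card ≤ k) :
    LinearIndepOn ℝ (extNormals u w) (t : Set (J ⊕ Option κ)) := by
  classical
  have hcard : t.toLeft.card + t.toRight.card = t.card := Finset.card_toLeft_add_card_toRight
  have hν : ‖slantVec κ w‖ ≠ 0 := by have := one_le_norm_slantVec (κ := κ) w; linarith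
  rw [linearIndepOn_finset_iff]
  intro f hf
  set ν := ‖slantVec κ w‖ with hνdef
  set g : Option κ → ℝ := fun o => if o ∈ t.toRight then f (.inr o) else 0 with hg
  have hsplit : ∑ j ∈ t.toLeft, f (.inl j) • extNormals u w (.inl j) +
      ∑ o, g o • extNormals (κ := κ) u w (.inr o) = 0 := by
    rw [← hf]
    conv_rhs => rw [← Finset.toLeft_disjSum_toRight (u := t), Finset.sum_disjSum]
    congr 1
    simp only [hg, ite_smul, zero_smul]
    rw [Finset.sum_ite_mem, Finset.univ_inter]
  rw [Fintype.sum_option] at hsplit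
  have hfst : ∑ j ∈ t.toLeft, f (.inl j) • u j + (g none * ν⁻¹) • w = 0 := by
    have := congrArg (WithLp.fstL 2 ℝ E (EuclideanSpace ℝ κ)) hsplit
    simp only [map_add, map_sum, map_smul] at this
    rw [hνdef]
    simpa [extNormals, slantVec, smul_smul] using this
  have hsnd : ∀ i, g (some i) = g none * ν⁻¹ := fun i => by
    have := congrArg (fun p => WithLp.sndL 2 ℝ E (EuclideanSpace ℝ κ) p i) hsplit
    simp only [map_add, map_sum, map_smul] at this
    rw [hνdef]
    simp [extNormals, slantVec, Finset.sum_apply, Pi.single_apply] at this ⊢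
    linarith
  have h0 : g none = 0 := by
    by_contra h0
    have hall : t.toRight = Finset.univ := by
      ext o
      simp only [Finset.mem_univ, iff_true]
      by_contra ho
      have hgo : g o = 0 := by simp only [hg]; rw [if_neg ho]
      rcases o with _ | i
      · exact h0 hgo
      · rw [hsnd i] at hgo
        exact (mul_ne_zero h0 (inv_ne_zero hν)) hgo
    refine hw t.toLeft ?_ ?_
    · rw [hall, Finset.card_univ, Fintype.card_option] at hcard
      omega
    · have h1 : (g none * ν⁻¹) • w ∈ Submodule.span ℝ (u '' (t.toLeft : Set J)) := by
        rw [← neg_eq_of_add_eq_zero_right hfst]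
        exact Submodule.neg_mem _ (Submodule.sum_mem _ fun j hj => Submodule.smul_mem _ _
          (Submodule.subset_span ⟨j, hj, rfl⟩))
      exact (Submodule.smul_mem_iff _ (mul_ne_zero h0 (inv_ne_zero hν))).1 h1
  rw [h0, zero_mul, zero_smul, add_zero] at hfst
  have hl := linearIndepOn_finset_iff.1 (hu t.toLeft (by omega)) _ hfst
  rintro (j | o) hj
  · exact hl j (by simpa using hj)
  · have ho : g o = f (.inr o) := by simp [hg, hj]
    rw [← ho]
    rcases o with _ | i
    · exact h0
    · rw [hsnd, h0, zero_mul]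

theorem IsFacetSystem.extNormals [Nonempty κ] {u : J → E} {w : E} {k : ℕ} {R : ℝ}
    (hu : IsFacetSystem u (fun _ => -1) k) (hR : 1 ≤ R)
    (hwQ : ∀ x ∈ polyhedron u (fun _ => -1), |⟪x, w⟫| ≤ 1)
    (hcut : ∀ j, ∃ x, ⟪x, u j⟫ < -1 ∧ (∀ i, i ≠ j → -1 ≤ ⟪x, u i⟫) ∧ |⟪x, w⟫| ≤ 1)
    (hw : ∀ t : Finset J, t.card + (Fintype.card κ + 1) ≤ k →
      w ∉ Submodule.span ℝ (u '' (t : Set J))) :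
    IsFacetSystem (extNormals u w) (extOffsets J κ R) k where
  norm_eq_one := norm_extNormals hu.norm_eq_one w
  neg := by
    rintro (j | o)
    · simp [extOffsets]
    · simp [extOffsets]; linarith
  linearIndepOn := linearIndepOn_extNormals hu.linearIndepOn hw
  isBounded := by
    obtain ⟨B, hB⟩ := isBounded_iff_forall_norm_le.1 hu.isBounded
    set ν := ‖slantVec κ w‖ with hν
    set C := 1 + R * ν + Fintype.card κ * R + R with hC
    have hν1 : 1 ≤ ν := one_le_norm_slantVec w
    have hcard : (0 : ℝ) ≤ Fintype.card κ := by positivity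
    refine isBounded_iff_forall_norm_le.2 ⟨√(B ^ 2 + Fintype.card κ * C ^ 2), fun p hp => ?_⟩
    have hp' : p ∈ polyhedron (_root_.extNormals u w) (fun j => extOffsets J κ R j + 0) := by
      simpa using hp
    rw [mem_polyhedron_extNormals] at hp'
    obtain ⟨h1, h2, h3⟩ := hp'
    simp only [add_zero, zero_sub] at h1 h2 h3
    have h4 := (abs_le.1 (hwQ _ h1)).2
    have h5 : ∀ i, |p.snd i| ≤ C := by
      intro i
      have h6 : ∑ j, (p.snd j + R) ≥ p.snd i + R :=
        Finset.single_le_sum (f := fun j => p.snd j + R)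
          (fun j _ => by linarith [h2 j]) (Finset.mem_univ i)
      rw [Finset.sum_add_distrib] at h6
      simp only [Finset.sum_const, Finset.card_univ, nsmul_eq_mul] at h6
      have h7 : 0 ≤ R * ν := by positivity
      have h8 : 0 ≤ Fintype.card κ * R := by positivity
      exact abs_le.2 ⟨by linarith [h2 i], by linarith⟩
    refine Real.le_sqrt_of_sq_le ?_
    rw [WithLp.prod_norm_sq_eq_of_L2, EuclideanSpace.norm_sq_eq]
    refine add_le_add (pow_le_pow_left₀ (norm_nonneg _) (hB _ h1) 2) ?_
    refine (Finset.sum_le_sum fun i _ => pow_le_pow_left₀ (norm_nonneg _) (h5 i) 2).trans ?_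
    simp
  exists_cut := by
    classical
    have hν := one_le_norm_slantVec (κ := κ) w
    rintro (j | _ | i)
    · obtain ⟨x, hx, hxi, hxw⟩ := hcut j
      refine ⟨toLp 2 (x, 0), by simpa [inner_extNormals_inl, extOffsets], ?_⟩
      rintro (i | _ | i) hi
      · rw [inner_extNormals_inl]
        exact hxi i (by simpa using hi)
      · rw [le_inner_extNormals_none]
        simp only [extOffsets, Sum.elim_inr]
        simp
        nlinarith [(abs_le.1 hxw).1]
      · rw [inner_extNormals_some]
        simp [extOffsets]
        linarith
    · set a := R * ‖slantVec κ w‖ + 1 with ha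
      have ha0 : 0 ≤ a := by positivity
      refine ⟨toLp 2 (0, toLp 2 fun _ => a), ?_, ?_⟩
      · rw [← not_le, le_inner_extNormals_none]
        have : (1 : ℝ) ≤ Fintype.card κ := by exact_mod_cast Fintype.card_pos
        simp [extOffsets]
        nlinarith
      · rintro (i | _ | i) hi
        · rw [inner_extNormals_inl]; simp [extOffsets]
        · exact absurd rfl hi
        · rw [inner_extNormals_some]
          simp [extOffsets]
          linarith
    · refine ⟨toLp 2 (0, EuclideanSpace.single i (-(R + 1))), ?_, ?_⟩
      · rw [inner_extNormals_some]
        simp [extOffsets]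
      · rintro (j | _ | j) hj
        · rw [inner_extNormals_inl]; simp [extOffsets]
        · rw [le_inner_extNormals_none]
          simp [extOffsets]
          nlinarith
        · rw [inner_extNormals_some]
          have : j ≠ i := by simpa using hj
          simp [extOffsets, this]
          linarith

theorem exists_slant [FiniteDimensional ℝ E] [Fintype J] (u : J → E) {n k : ℕ}
    (hk : k ≤ finrank ℝ E ∨ k ≤ n) {S : Set E} (hS : Bornology.IsBounded S) :
    ∃ w : E, (∀ x ∈ S, |⟪x, w⟫| ≤ 1) ∧
      ∀ t : Finset J, t.card + (n + 1) ≤ k → w ∉ Submodule.span ℝ (u '' (t : Set J)) := by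
  classical
  set s : Finset (Submodule ℝ E) := (Finset.univ.filter fun t : Finset J =>
    t.card + (n + 1) ≤ k).image fun t : Finset J => Submodule.span ℝ (u '' (t : Set J)) with hs
  have htop : ⊤ ∉ s := by
    intro h
    obtain ⟨t, ht, htop⟩ := Finset.mem_image.1 h
    have htk : t.card + (n + 1) ≤ k := (Finset.mem_filter.1 ht).2
    have h1 : finrank ℝ (Submodule.span ℝ (u '' (t : Set J))) ≤ t.card := by
      rw [← Finset.coe_image]
      exact (finrank_span_finset_le_card _).trans Finset.card_image_le
    rw [htop, finrank_top] at h1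
    omega
  obtain ⟨w, hw⟩ := (ne_univ_iff_exists_notMem _).1 (Subspace.biUnion_ne_univ_of_top_notMem htop)
  obtain ⟨B, hB0, hB⟩ := hS.exists_pos_norm_le
  have hpos : 0 < B * ‖w‖ + 1 := by positivity
  refine ⟨(B * ‖w‖ + 1)⁻¹ • w, fun x hx => ?_, fun t ht hmem => hw ?_⟩
  · rw [inner_smul_right, abs_mul, abs_of_pos (inv_pos.2 hpos), inv_mul_eq_div, div_le_one hpos]
    have h1 := abs_real_inner_le_norm x w
    have h2 := mul_le_mul_of_nonneg_right (hB x hx) (norm_nonneg w)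
    linarith
  · rw [mem_iUnion₂]
    exact ⟨_, Finset.mem_image.2 ⟨t, Finset.mem_filter.2 ⟨Finset.mem_univ _, ht⟩, rfl⟩,
      (Submodule.smul_mem_iff _ (inv_ne_zero hpos.ne')).1 hmem⟩

/-- A facet system circumscribed about the unit ball extends to a facet system in a product
space, with a slope `w` that is at most `1` in absolute value on the base. -/
theorem IsFacetSystem.exists_extNormals [Nonempty κ] [FiniteDimensional ℝ E] [Fintype J]
    {u : J → E} {k : ℕ} (hu : IsFacetSystem u (fun _ => -1) k)
    (hk : k ≤ finrank ℝ E ∨ k ≤ Fintype.card κ) :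
    ∃ w : E, (∀ x ∈ polyhedron u (fun _ => -1), |⟪x, w⟫| ≤ 1) ∧
      ∀ R, 1 ≤ R → IsFacetSystem (_root_.extNormals (κ := κ) u w) (extOffsets J κ R) k := by
  choose x hx hxi using hu.exists_cut
  obtain ⟨w, hw, hwt⟩ := exists_slant u hk (hu.isBounded.union (finite_range x).isBounded)
  have hwQ : ∀ x ∈ polyhedron u (fun _ => -1), |⟪x, w⟫| ≤ 1 := fun x hx => hw x (.inl hx)
  exact ⟨w, hwQ, fun R hR => hu.extNormals hR hwQ
    (fun j => ⟨x j, hx j, hxi j, hw _ (.inr ⟨j, rfl⟩)⟩) hwt⟩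

theorem exists_not_linearIndepOn_of_comp {J' E' : Type*} [AddCommGroup E'] [Module ℝ E']
    {u : J → E} {v : J' → E'} {k : ℕ}
    (hu : ∃ t : Finset J, t.card = k ∧ ¬ LinearIndepOn ℝ u (t : Set J))
    {f : J → J'} (hf : f.Injective) (L : E →ₗ[ℝ] E') (h : ∀ j, v (f j) = L (u j)) :
    ∃ t : Finset J', t.card = k ∧ ¬ LinearIndepOn ℝ v (t : Set J') := by
  obtain ⟨t, ht, hdep⟩ := hu
  refine ⟨t.map ⟨f, hf⟩, by simpa, fun hind => hdep ?_⟩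
  have h1 : LinearIndepOn ℝ (v ∘ f) (t : Set J) := by
    rw [Finset.coe_map] at hind
    exact hind.comp_of_image hf.injOn
  rw [show v ∘ f = L ∘ u from funext h] at h1
  exact LinearIndependent.of_comp L h1

theorem extNormals_exists_not_linearIndepOn {u : J → E} {k : ℕ} (w : E)
    (hu : ∃ t : Finset J, t.card = k ∧ ¬ LinearIndepOn ℝ u (t : Set J)) :
    ∃ t : Finset (J ⊕ Option κ), t.card = k ∧
      ¬ LinearIndepOn ℝ (extNormals u w) (t : Set (J ⊕ Option κ)) :=
  exists_not_linearIndepOn_of_comp hu Sum.inl_injective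
    ((WithLp.linearEquiv 2 ℝ (E × EuclideanSpace ℝ κ)).symm.toLinearMap ∘ₗ
      LinearMap.inl ℝ E (EuclideanSpace ℝ κ)) fun _ => rfl

end Extension

section Transport

variable {E E' J J' : Type*} [NormedAddCommGroup E] [InnerProductSpace ℝ E]
  [NormedAddCommGroup E'] [InnerProductSpace ℝ E'] {u : J → E} {c : J → ℝ} {k : ℕ}

theorem polyhedron_comp (Φ : E ≃ₗᵢ[ℝ] E') (e : J' ≃ J) (u : J → E) (c : J → ℝ) :
    polyhedron (Φ ∘ u ∘ e) (c ∘ e) = Φ.symm ⁻¹' polyhedron u c := by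
  ext x
  simp only [polyhedron, mem_preimage, mem_ofPred_eq, Function.comp_apply]
  rw [← e.forall_congr_right (q := fun j => c j ≤ ⟪Φ.symm x, u j⟫)]
  refine forall_congr' fun j => ?_
  rw [← Φ.inner_map_map, Φ.apply_symm_apply]

theorem IsFacetSystem.comp (hu : IsFacetSystem u c k) (Φ : E ≃ₗᵢ[ℝ] E') (e : J' ≃ J) :
    IsFacetSystem (Φ ∘ u ∘ e) (c ∘ e) k where
  norm_eq_one j := by simp [hu.norm_eq_one]
  neg j := hu.neg _
  exists_cut j := by
    obtain ⟨x, hx, hxi⟩ := hu.exists_cut (e j)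
    exact ⟨Φ x, by simpa, fun i hi => by simpa using hxi (e i) (by simpa)⟩
  isBounded := by
    rw [polyhedron_comp, ← Φ.image_eq_preimage_symm]
    exact Φ.lipschitz.isBounded_image hu.isBounded
  linearIndepOn t ht := by
    have h1 := hu.linearIndepOn (t.map e.toEmbedding) (by simpa)
    rw [Finset.coe_map] at h1
    have h2 : LinearIndepOn ℝ (u ∘ e) (t : Set J') := h1.comp_of_image e.injective.injOn
    exact h2.map' Φ.toLinearEquiv.toLinearMap (LinearEquiv.ker _)

theorem exists_not_linearIndepOn_comp
    (hu : ∃ t : Finset J, t.card = k ∧ ¬ LinearIndepOn ℝ u (t : Set J))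
    (Φ : E ≃ₗᵢ[ℝ] E') (e : J' ≃ J) :
    ∃ t : Finset J', t.card = k ∧ ¬ LinearIndepOn ℝ (Φ ∘ u ∘ e) (t : Set J') :=
  exists_not_linearIndepOn_of_comp hu e.symm.injective Φ.toLinearEquiv.toLinearMap
    fun j => by simp

end Transport

section Existence

open Module WithLp

theorem IsFacetSystem.exists_fin {E J : Type*} [NormedAddCommGroup E] [InnerProductSpace ℝ E]
    [FiniteDimensional ℝ E] [Fintype J] {u : J → E} {k d : ℕ}
    (hu : IsFacetSystem u (fun _ => -1) k) (hd : finrank ℝ E = d)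
    (hdep : ∃ t : Finset J, t.card = k + 1 ∧ ¬ LinearIndepOn ℝ u (t : Set J)) :
    ∃ (m : ℕ) (v : Fin m → EuclideanSpace ℝ (Fin d)), IsFacetSystem v (fun _ => -1) k ∧
      ∃ t : Finset (Fin m), t.card = k + 1 ∧ ¬ LinearIndepOn ℝ v (t : Set (Fin m)) := by
  subst hd
  exact ⟨Fintype.card J, _, hu.comp (stdOrthonormalBasis ℝ E).repr (Fintype.equivFin J).symm,
    exists_not_linearIndepOn_comp hdep _ _⟩

theorem finrank_withLp_prod (E : Type*) [NormedAddCommGroup E] [InnerProductSpace ℝ E]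
    [FiniteDimensional ℝ E] (n : ℕ) :
    finrank ℝ (WithLp 2 (E × EuclideanSpace ℝ (Fin n))) = finrank ℝ E + n := by
  rw [(WithLp.linearEquiv 2 ℝ (E × EuclideanSpace ℝ (Fin n))).finrank_eq, finrank_prod,
    finrank_euclideanSpace_fin]

theorem exists_isFacetSystem_simplex {k : ℕ} (hk : 1 ≤ k) :
    ∃ (m : ℕ) (v : Fin m → EuclideanSpace ℝ (Fin k)), IsFacetSystem v (fun _ => -1) k ∧
      ∃ t : Finset (Fin m), t.card = k + 1 ∧ ¬ LinearIndepOn ℝ v (t : Set (Fin m)) := by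
  have : Nonempty (Fin k) := ⟨⟨0, hk⟩⟩
  have h0 : IsFacetSystem (Fin.elim0 : Fin 0 → EuclideanSpace ℝ (Fin 0)) (fun _ => -1) k :=
    { norm_eq_one := fun j => j.elim0
      neg := fun j => j.elim0
      exists_cut := fun j => j.elim0
      isBounded := (toFinite _).isBounded
      linearIndepOn := fun t _ => by
        rw [Subsingleton.elim t ∅, Finset.coe_empty]
        exact linearIndepOn_empty _ _ }
  obtain ⟨w, -, hw⟩ := h0.exists_extNormals (κ := Fin k) (.inr (by simp))
  have h1 := hw 1 le_rfl
  rw [extOffsets_one] at h1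
  have hd : finrank ℝ (WithLp 2 (EuclideanSpace ℝ (Fin 0) × EuclideanSpace ℝ (Fin k))) = k := by
    simp [finrank_withLp_prod]
  refine h1.exists_fin hd ⟨Finset.univ, by simp, fun h => ?_⟩
  have := LinearIndependent.fintype_card_le_finrank h
  simp [hd] at this

theorem exists_isFacetSystem {k s : ℕ} (hk : 1 ≤ k) (hks : k ≤ s) :
    ∃ (m : ℕ) (v : Fin m → EuclideanSpace ℝ (Fin s)), IsFacetSystem v (fun _ => -1) k ∧
      ∃ t : Finset (Fin m), t.card = k + 1 ∧ ¬ LinearIndepOn ℝ v (t : Set (Fin m)) := by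
  obtain ⟨m, u, hu, hdep⟩ := exists_isFacetSystem_simplex hk
  rcases hks.eq_or_lt with rfl | hlt
  · exact ⟨m, u, hu, hdep⟩
  · have : Nonempty (Fin (s - k)) := ⟨⟨0, by omega⟩⟩
    obtain ⟨w, -, hw⟩ := hu.exists_extNormals (κ := Fin (s - k)) (.inl (by simp))
    have h1 := hw 1 le_rfl
    rw [extOffsets_one] at h1
    exact h1.exists_fin (by rw [finrank_withLp_prod]; simp; omega)
      (extNormals_exists_not_linearIndepOn w hdep)

end Existence

section Volume

open Module WithLp Pointwise

/-- The standard simplex `{y | 0 ≤ y i, ∑ y i ≤ 1}`. -/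
def cornerSimplex (κ : Type*) [Fintype κ] : Set (EuclideanSpace ℝ κ) :=
  {y | (∀ i, 0 ≤ y i) ∧ ∑ i, y i ≤ 1}

variable {κ : Type*} [Fintype κ]

theorem volume_real_scaled_cornerSimplex {a b : ℝ} (h : 0 < b - Fintype.card κ * a) :
    volume.real {y : EuclideanSpace ℝ κ | (∀ i, a ≤ y i) ∧ ∑ i, y i ≤ b} =
      (b - Fintype.card κ * a) ^ Fintype.card κ * volume.real (cornerSimplex κ) := by
  set σ := b - Fintype.card κ * a with hσ
  have hset : {y : EuclideanSpace ℝ κ | (∀ i, a ≤ y i) ∧ ∑ i, y i ≤ b} =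
      (fun y => toLp 2 (fun _ => -a) + y) ⁻¹' (σ • cornerSimplex κ) := by
    ext y
    rw [mem_preimage, mem_smul_set_iff_inv_smul_mem₀ h.ne']
    simp only [cornerSimplex, mem_ofPred_eq, PiLp.smul_apply, PiLp.add_apply, smul_eq_mul,
      ← Finset.mul_sum, Finset.sum_add_distrib, Finset.sum_const, Finset.card_univ, nsmul_eq_mul]
    refine and_congr (forall_congr' fun i => ?_) ?_
    · rw [mul_nonneg_iff_of_pos_left (inv_pos.2 h), neg_add_eq_sub, sub_nonneg]
    · rw [inv_mul_le_one₀ h, hσ]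
      constructor <;> intro <;> linarith
  rw [hset, measureReal_def, measure_preimage_add, Measure.addHaar_smul, ENNReal.toReal_mul,
    ENNReal.toReal_ofReal (abs_nonneg _), finrank_euclideanSpace, abs_of_pos (by positivity),
    measureReal_def]

theorem volume_real_cornerSimplex_pos : 0 < volume.real (cornerSimplex κ) := by
  have hb : Bornology.IsBounded (cornerSimplex κ) := by
    refine isBounded_iff_forall_norm_le.2 ⟨√(Fintype.card κ), fun y hy => ?_⟩
    refine Real.le_sqrt_of_sq_le ?_
    rw [EuclideanSpace.norm_sq_eq]
    have h1 : ∀ i, ‖y i‖ ^ 2 ≤ 1 := fun i => by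
      have h2 : y i ≤ 1 :=
        (Finset.single_le_sum (fun j _ => hy.1 j) (Finset.mem_univ i)).trans hy.2
      rw [Real.norm_of_nonneg (hy.1 i)]
      nlinarith [hy.1 i]
    exact (Finset.sum_le_sum fun i _ => h1 i).trans (by simp)
  refine ENNReal.toReal_pos ?_ hb.measure_lt_top.ne
  have ho : IsOpen {y : EuclideanSpace ℝ κ | (∀ i, 0 < y i) ∧ ∑ i, y i < 1} := by
    rw [show {y : EuclideanSpace ℝ κ | (∀ i, 0 < y i) ∧ ∑ i, y i < 1} =
      (⋂ i, {y | 0 < y i}) ∩ {y | ∑ i, y i < 1} by ext; simp]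
    exact (isOpen_iInter_of_finite fun i => isOpen_lt continuous_const (by fun_prop)).inter
      (isOpen_lt (by fun_prop) continuous_const)
  have hne : {y : EuclideanSpace ℝ κ | (∀ i, 0 < y i) ∧ ∑ i, y i < 1}.Nonempty := by
    refine ⟨toLp 2 fun _ => ((Fintype.card κ : ℝ) + 1)⁻¹, fun i => by positivity, ?_⟩
    simp only [Finset.sum_const, Finset.card_univ, nsmul_eq_mul]
    rw [← div_eq_mul_inv, div_lt_one (by positivity)]
    linarith
  have hsub : {y : EuclideanSpace ℝ κ | (∀ i, 0 < y i) ∧ ∑ i, y i < 1} ⊆ cornerSimplex κ :=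
    fun y hy => ⟨fun i => (hy.1 i).le, hy.2.le⟩
  exact ((ho.measure_pos volume hne).trans_le (measure_mono hsub)).ne'

variable {E J : Type*} [NormedAddCommGroup E] [InnerProductSpace ℝ E] {u : J → E} {k : ℕ}

theorem polyhedron_eq_smul {r : ℝ} (hr : r < 1) :
    polyhedron u (fun _ => -1 + r) = (1 - r) • polyhedron u fun _ => -1 := by
  have h : 0 < 1 - r := by linarith
  ext x
  rw [mem_smul_set_iff_inv_smul_mem₀ h.ne']
  simp only [polyhedron, mem_ofPred_eq, inner_smul_left, conj_trivial]
  refine forall_congr' fun j => ?_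
  rw [inv_mul_eq_div, le_div_iff₀ h]
  constructor <;> intro <;> linarith

theorem IsFacetSystem.polyhedron_subset_zero (hu : IsFacetSystem u (fun _ => -1) k) {r : ℝ}
    (hr : 1 ≤ r) : polyhedron u (fun _ => -1 + r) ⊆ {0} := by
  intro x hx
  by_contra hx0
  obtain ⟨B, hB0, hB⟩ := hu.isBounded.exists_pos_norm_le
  have hn : 0 < ‖x‖ := norm_pos_iff.2 hx0
  have hmem : ((B + 1) / ‖x‖) • x ∈ polyhedron u fun _ => -1 := fun j => by
    rw [inner_smul_left]
    have h1 := hx j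
    have h2 : 0 ≤ (B + 1) / ‖x‖ * ⟪x, u j⟫ := mul_nonneg (by positivity) (by linarith)
    simp only [conj_trivial]
    linarith
  have := hB _ hmem
  rw [norm_smul, norm_div, norm_norm, div_mul_cancel₀ _ hn.ne',
    Real.norm_of_nonneg (by linarith)] at this
  linarith

variable [FiniteDimensional ℝ E] [MeasurableSpace E] [BorelSpace E]

theorem IsFacetSystem.volume_real_pos [Finite J] {c : J → ℝ} (hu : IsFacetSystem u c k) :
    0 < volume.real (polyhedron u c) := by
  have h : (interior (polyhedron u c)).Nonempty :=
    ⟨0, mem_interior_polyhedron fun j => by simpa using hu.neg j⟩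
  exact ENNReal.toReal_pos (Measure.measure_pos_of_nonempty_interior _ h).ne'
    hu.isBounded.measure_lt_top.ne

theorem IsFacetSystem.volume_polyhedron_eq_zero (hu : IsFacetSystem u (fun _ => -1) k)
    (hE : 1 ≤ finrank ℝ E) {r : ℝ} (hr : 1 ≤ r) :
    volume (polyhedron u fun _ => -1 + r) = 0 := by
  have : Nontrivial E := Module.finrank_pos_iff.1 hE
  exact measure_mono_null (hu.polyhedron_subset_zero hr) (by simp)

theorem IsFacetSystem.volume_real_polyhedron (hu : IsFacetSystem u (fun _ => -1) k)
    (hE : 1 ≤ finrank ℝ E) (r : ℝ) :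
    volume.real (polyhedron u fun _ => -1 + r) =
      (max (1 - r) 0) ^ finrank ℝ E * volume.real (polyhedron u fun _ => -1) := by
  rcases lt_or_ge r 1 with hr | hr
  · rw [polyhedron_eq_smul hr, measureReal_def, Measure.addHaar_smul, ENNReal.toReal_mul,
      ENNReal.toReal_ofReal (abs_nonneg _), max_eq_left (by linarith), measureReal_def,
      abs_of_nonneg (pow_nonneg (by linarith) _)]
  · rw [measureReal_def, hu.volume_polyhedron_eq_zero hE hr, max_eq_right (by linarith),
      zero_pow (by omega)]
    simp

theorem contDiff_setIntegral_add_mul_pow {K : Set E} (hK : IsCompact K) {A B : ℝ → ℝ}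
    (hA : ContDiff ℝ ∞ A) (hB : ContDiff ℝ ∞ B) {ℓ : E → ℝ} (hℓ : Continuous ℓ) (n : ℕ) :
    ContDiff ℝ ∞ fun r => ∫ z in K, (A r + B r * ℓ z) ^ n := by
  have h : (fun r => ∫ z in K, (A r + B r * ℓ z) ^ n) = fun r =>
      ∑ m ∈ Finset.range (n + 1),
        A r ^ m * B r ^ (n - m) * (n.choose m) * ∫ z in K, ℓ z ^ (n - m) := by
    ext r
    simp_rw [add_pow]
    rw [integral_finsetSum]
    · refine Finset.sum_congr rfl fun m _ => ?_
      rw [← integral_const_mul]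
      congr 1
      ext z
      ring
    · intro m _
      exact ContinuousOn.integrableOn_compact hK (by fun_prop)
  rw [h]
  fun_prop

theorem measureReal_eq_integral_section {F : Type*} [NormedAddCommGroup F]
    [InnerProductSpace ℝ F] [FiniteDimensional ℝ F] [MeasurableSpace F] [BorelSpace F]
    {S : Set (WithLp 2 (E × F))} (hS : MeasurableSet S) (hfin : volume S ≠ ⊤) :
    volume.real S = ∫ x : E, volume.real {y : F | toLp 2 (x, y) ∈ S} := by
  have hmp := WithLp.volume_preserving_toLp E F
  have hm : MeasurableSet (toLp 2 ⁻¹' S : Set (E × F)) := hmp.measurable hS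
  have hv : (volume.prod volume) (toLp 2 ⁻¹' S : Set (E × F)) = volume S :=
    hmp.measure_preimage hS.nullMeasurableSet
  rw [measureReal_def, ← hv, Measure.prod_apply hm, ← integral_toReal]
  · rfl
  · exact (measurable_measure_prodMk_left hm).aemeasurable
  · exact Measure.ae_measure_lt_top hm (by rwa [hv])

theorem IsFacetSystem.volume_real_polyhedron_extNormals [Nonempty κ] [Finite J] {w : E} {R : ℝ}
    (hu : IsFacetSystem u (fun _ => -1) k) (hE : 1 ≤ finrank ℝ E) (hR : 1 < R)
    (hwQ : ∀ x ∈ polyhedron u (fun _ => -1), |⟪x, w⟫| ≤ 1)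
    (hN : IsFacetSystem (_root_.extNormals (κ := κ) u w) (extOffsets J κ R) k) :
    ∃ G : ℝ → ℝ, ContDiff ℝ ∞ G ∧ G 1 ≠ 0 ∧ ∀ r, 0 ≤ r →
      volume.real (polyhedron (_root_.extNormals (κ := κ) u w)
        fun j => extOffsets J κ R j + r) = (max (1 - r) 0) ^ finrank ℝ E * G r := by
  set ν := ‖slantVec κ w‖ with hν
  have hν1 : 1 ≤ ν := one_le_norm_slantVec w
  set n := Fintype.card κ with hn
  set τ : ℝ := ν + n with hτ
  have hτ1 : 1 ≤ τ := by have : (0 : ℝ) ≤ n := by positivity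
                         linarith
  set Q := polyhedron u fun _ => -1 with hQ
  have hQc : IsCompact Q := Metric.isCompact_of_isClosed_isBounded (isClosed_polyhedron _ _)
    hu.isBounded
  have hvol := volume_real_cornerSimplex_pos (κ := κ)
  refine ⟨fun r => (∫ z in Q, ((R - r) * τ + (1 - r) * ⟪z, w⟫) ^ n) *
    volume.real (cornerSimplex κ), ?_, ?_, ?_⟩
  · exact (contDiff_setIntegral_add_mul_pow hQc (by fun_prop) (by fun_prop)
      (by fun_prop) n).mul contDiff_const
  · have h1 := hu.volume_real_pos
    have h2 : 0 < R - 1 := by linarith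
    simp only [sub_self, zero_mul, add_zero, setIntegral_const, smul_eq_mul]
    positivity
  · intro r hr
    have hsec : ∀ x, {y : EuclideanSpace ℝ κ | toLp 2 (x, y) ∈
        polyhedron (_root_.extNormals u w) fun j => extOffsets J κ R j + r} =
        {y | x ∈ polyhedron u (fun _ => -1 + r) ∧ (∀ i, r - R ≤ y i) ∧
          ∑ i, y i ≤ ⟪x, w⟫ - (r - R) * ν} := by
      intro x
      ext y
      simp only [mem_ofPred_eq, mem_polyhedron_extNormals]
      refine and_congr_right' (and_congr_right' ?_)
      change (r - R) * ν ≤ ⟪x, w⟫ - ∑ i, y i ↔ _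
      constructor <;> intro h <;> linarith
    have hfin : volume (polyhedron (_root_.extNormals (κ := κ) u w)
        fun j => extOffsets J κ R j + r) ≠ ⊤ :=
      (hN.isBounded.subset fun p hp j => by linarith [hp j]).measure_lt_top.ne
    rw [measureReal_eq_integral_section (isClosed_polyhedron _ _).measurableSet hfin]
    simp_rw [hsec]
    have hind : (fun x => volume.real {y : EuclideanSpace ℝ κ |
        x ∈ polyhedron u (fun _ => -1 + r) ∧ (∀ i, r - R ≤ y i) ∧
          ∑ i, y i ≤ ⟪x, w⟫ - (r - R) * ν}) =
        (polyhedron u fun _ => -1 + r).indicator fun x =>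
          volume.real {y : EuclideanSpace ℝ κ | (∀ i, r - R ≤ y i) ∧
            ∑ i, y i ≤ ⟪x, w⟫ - (r - R) * ν} := by
      ext x
      by_cases hx : x ∈ polyhedron u (fun _ => -1 + r) <;> simp [hx]
    rw [hind, integral_indicator (isClosed_polyhedron _ _).measurableSet]
    rcases lt_or_ge r 1 with hr1 | hr1
    · have h1r : 0 < 1 - r := by linarith
      have hscale := Measure.setIntegral_comp_smul_of_pos volume
        (fun x => volume.real {y : EuclideanSpace ℝ κ | (∀ i, r - R ≤ y i) ∧
            ∑ i, y i ≤ ⟪x, w⟫ - (r - R) * ν}) Q h1r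
      rw [polyhedron_eq_smul hr1, max_eq_left h1r.le, ← hQ]
      rw [smul_eq_mul, eq_inv_mul_iff_mul_eq₀ (by positivity)] at hscale
      rw [← hscale, ← integral_mul_const]
      congr 1
      refine setIntegral_congr_fun (isClosed_polyhedron _ _).measurableSet fun z hz => ?_
      have hσ : ⟪(1 - r) • z, w⟫ - (r - R) * ν - n * (r - R) =
          (R - r) * τ + (1 - r) * ⟪z, w⟫ := by
        rw [inner_smul_left, hτ]
        simp only [conj_trivial]
        ring
      have hpos : 0 < (R - r) * τ + (1 - r) * ⟪z, w⟫ := by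
        have h1 := (abs_le.1 (hwQ z hz)).1
        nlinarith
      simp only
      rw [volume_real_scaled_cornerSimplex (by rw [hσ]; exact hpos), hσ]
    · rw [setIntegral_measure_zero _ (hu.volume_polyhedron_eq_zero hE hr1),
        max_eq_right (by linarith), zero_pow (by omega), zero_mul]

end Volume

theorem exists_polytope_of_isFacetSystem {d k s : ℕ} {E J : Type*} [NormedAddCommGroup E]
    [InnerProductSpace ℝ E] [FiniteDimensional ℝ E] [MeasurableSpace E] [BorelSpace E] [Fintype J]
    {u₀ : J → E} {c₀ : J → ℝ} (hs : 1 ≤ s) (hu₀ : IsFacetSystem u₀ c₀ k)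
    (hd : Module.finrank ℝ E = d)
    (hdep₀ : ∃ t : Finset J, t.card = k + 1 ∧ ¬ LinearIndepOn ℝ u₀ (t : Set J))
    {G : ℝ → ℝ} (hG : ContDiff ℝ ∞ G) (hG1 : G 1 ≠ 0)
    (hvol : ∀ r, 0 ≤ r → volume.real (polyhedron u₀ fun j => c₀ j + r) =
      (max (1 - r) 0) ^ s * G r) :
    ∃ (P : Set (EuclideanSpace ℝ (Fin d))) (m : ℕ)
      (N : Fin m → EuclideanSpace ℝ (Fin d)) (c : Fin m → ℝ),
      (∀ j, ‖N j‖ = 1) ∧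
      P = (⋂ j, {x : EuclideanSpace ℝ (Fin d) | c j ≤ ⟪x, N j⟫}) ∧
      (∀ j : Fin m,
        (⋂ i ∈ Finset.univ.erase j, {x : EuclideanSpace ℝ (Fin d) | c i ≤ ⟪x, N i⟫}) ≠ P) ∧
      IsCompact P ∧ (interior P).Nonempty ∧
      AbsoluteRank N k ∧
      ContDiffOn ℝ (s - 1 : ℕ) (VP P) (Ici 0) ∧
      ¬ ContDiffOn ℝ (s : ℕ) (VP P) (Ici 0) := by
  subst hd
  set Φ := (stdOrthonormalBasis ℝ E).repr
  set e := (Fintype.equivFin J).symm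
  have hu := hu₀.comp Φ e
  have hdep := exists_not_linearIndepOn_comp hdep₀ Φ e
  have hcl := isClosed_polyhedron (Φ ∘ u₀ ∘ e) (c₀ ∘ e)
  have hfront : (frontier (polyhedron (Φ ∘ u₀ ∘ e) (c₀ ∘ e))).Nonempty := by
    obtain ⟨t, ht, -⟩ := hdep
    obtain ⟨j, -⟩ := Finset.card_pos.1 (by omega : 0 < t.card)
    obtain ⟨x, hx, -⟩ := hu.exists_cut j
    refine nonempty_frontier_iff.2 ⟨⟨0, fun j => by simpa using (hu.neg j).le⟩, fun h => ?_⟩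
    exact absurd ((h ▸ mem_univ x : x ∈ polyhedron (Φ ∘ u₀ ∘ e) (c₀ ∘ e)) j) (not_le.2 hx)
  have hV : ∀ r, 0 ≤ r → VP (polyhedron (Φ ∘ u₀ ∘ e) (c₀ ∘ e)) r =
      volume.real (polyhedron (Φ ∘ u₀ ∘ e) (c₀ ∘ e)) - (max (1 - r) 0) ^ s * G r := by
    intro r hr
    have hr' : volume.real (polyhedron (Φ ∘ u₀ ∘ e) fun j => (c₀ ∘ e) j + r) =
        (max (1 - r) 0) ^ s * G r := by
      rw [← hvol r hr]
      exact (congrArg volume.real (polyhedron_comp Φ e u₀ fun j => c₀ j + r)).trans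
        (Φ.symm.measurePreserving.measureReal_preimage
          (isClosed_polyhedron _ _).measurableSet.nullMeasurableSet)
    rw [← hr', VP, innerInterior_polyhedron hu.norm_eq_one hfront hr, ← measureReal_def]
    exact measureReal_sdiff (fun x hx j => by linarith [hx j])
      (isClosed_polyhedron _ _).measurableSet hu.isBounded.measure_lt_top.ne
  refine ⟨polyhedron (Φ ∘ u₀ ∘ e) (c₀ ∘ e), _, Φ ∘ u₀ ∘ e, c₀ ∘ e, hu.norm_eq_one, ?_, ?_,
    Metric.isCompact_of_isClosed_isBounded hcl hu.isBounded,
    ⟨0, mem_interior_polyhedron fun j => by simpa using hu.neg j⟩,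
    ⟨fun t ht => hu.linearIndepOn t ht.le, hdep⟩,
    contDiffOn_and_not_contDiffOn_of_eq hs hG hG1 hV⟩
  · ext x
    simp [polyhedron]
  · intro j h
    obtain ⟨x, hx, hxi⟩ := hu.exists_cut j
    refine absurd ((h ▸ ?_ : x ∈ polyhedron (Φ ∘ u₀ ∘ e) (c₀ ∘ e)) j) (not_le.2 hx)
    exact mem_iInter₂.2 fun i hi => hxi i (Finset.ne_of_mem_erase hi)

/-- For all `1 ≤ k ≤ s ≤ d` there is a polytope `P` in `ℝ^d` whose family of
inner unit facet normals has absolute rank `k`, and whose inner neighborhood volume function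
is of class `C^{s-1}` on `[0,∞)` but not of class `C^s`. -/
theorem statement8 (d k s : ℕ) (hk : 1 ≤ k) (hks : k ≤ s) (hsd : s ≤ d) :
    ∃ (P : Set (EuclideanSpace ℝ (Fin d))) (m : ℕ)
      (N : Fin m → EuclideanSpace ℝ (Fin d)) (c : Fin m → ℝ),
      (∀ j, ‖N j‖ = 1) ∧
      P = (⋂ j, {x : EuclideanSpace ℝ (Fin d) | c j ≤ ⟪x, N j⟫}) ∧
      (∀ j : Fin m,
        (⋂ i ∈ Finset.univ.erase j, {x : EuclideanSpace ℝ (Fin d) | c i ≤ ⟪x, N i⟫}) ≠ P) ∧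
      IsCompact P ∧ (interior P).Nonempty ∧
      AbsoluteRank N k ∧
      ContDiffOn ℝ (s - 1 : ℕ) (VP P) (Ici 0) ∧
      ¬ ContDiffOn ℝ (s : ℕ) (VP P) (Ici 0) := by
  obtain ⟨m, u, hu, hdep⟩ := exists_isFacetSystem hk hks
  have hs : 1 ≤ Module.finrank ℝ (EuclideanSpace ℝ (Fin s)) := by simp; omega
  rcases hsd.eq_or_lt with rfl | hlt
  · refine exists_polytope_of_isFacetSystem (hk.trans hks) hu (by simp) hdep
      (G := fun _ => volume.real (polyhedron u fun _ => -1)) contDiff_const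
      hu.volume_real_pos.ne' fun r _ => ?_
    rw [hu.volume_real_polyhedron hs, finrank_euclideanSpace_fin]
  · have : Nonempty (Fin (d - s)) := ⟨⟨0, by omega⟩⟩
    obtain ⟨w, hw, hN⟩ := hu.exists_extNormals (κ := Fin (d - s)) (.inl (by simpa))
    obtain ⟨G, hG, hG1, hvol⟩ :=
      hu.volume_real_polyhedron_extNormals hs one_lt_two hw (hN 2 one_le_two)
    rw [finrank_euclideanSpace_fin] at hvol
    exact exists_polytope_of_isFacetSystem (hk.trans hks) (hN 2 one_le_two)
      (by rw [finrank_withLp_prod, finrank_euclideanSpace_fin]; omega)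
      (extNormals_exists_not_linearIndepOn w hdep) hG hG1 hvol
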